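/- For all x, y, z where both sides are defined, ∑_{r,s=±} (φ₁(x − r y) φ₁(x − s z) + φ₁(y − r x) φ₁(y − s z) + φ₁(z − r x) φ₁(z − s y)) = 2 ∑_{r=±} (θ̇₁(x − r y)/θ₁(x − r y) + θ̇₁(x − r z)/θ₁(x − r z) + θ̇₁(y − r z)/θ₁(y − r z) + 3η₁/(2ω₁)). -/

import Mathlib

noncomputable section
open Complex

namespace Paper

/-- The half-period ω₃ as a function of β (using β = 2ω₁ω₃/(πi), with ω₁ held fixed). -/
def w3 (w1 b : ℂ) : ℂ := (Real.pi : ℂ) * I * b / (2 * w1)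

/-- The modular parameter τ = ω₃/ω₁. -/
def tau (w1 b : ℂ) : ℂ := w3 w1 b / w1

/-- R = 2ω₁/π. -/
def RR (w1 : ℂ) : ℂ := 2 * w1 / (Real.pi : ℂ)

/-- Jacobi theta function θ₁(x) = 2 ∑_{n≥0} (−1)ⁿ q^{(n+1/2)²} sin((2n+1)x/R), q = e^{iπτ}. -/
def theta1 (w1 b x : ℂ) : ℂ :=
  2 * ∑' n : ℕ, (-1 : ℂ) ^ n *
      Complex.exp ((Real.pi : ℂ) * I * tau w1 b * ((n : ℂ) + 1 / 2) ^ 2) *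
      Complex.sin ((2 * (n : ℂ) + 1) * x / RR w1)

/-- Jacobi theta function θ₂. -/
def theta2 (w1 b x : ℂ) : ℂ :=
  2 * ∑' n : ℕ,
      Complex.exp ((Real.pi : ℂ) * I * tau w1 b * ((n : ℂ) + 1 / 2) ^ 2) *
      Complex.cos ((2 * (n : ℂ) + 1) * x / RR w1)

/-- Jacobi theta function θ₃. -/
def theta3 (w1 b x : ℂ) : ℂ :=
  1 + 2 * ∑' n : ℕ,
      Complex.exp ((Real.pi : ℂ) * I * tau w1 b * ((n : ℂ) + 1) ^ 2) *
      Complex.cos (2 * ((n : ℂ) + 1) * x / RR w1)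

/-- Jacobi theta function θ₄. -/
def theta4 (w1 b x : ℂ) : ℂ :=
  1 + 2 * ∑' n : ℕ, (-1 : ℂ) ^ n *
      Complex.exp ((Real.pi : ℂ) * I * tau w1 b * ((n : ℂ) + 1) ^ 2) *
      Complex.cos (2 * ((n : ℂ) + 1) * x / RR w1)

/-- θ_{ν+1} for ν : Fin 4. -/
def theta (ν : Fin 4) (w1 b x : ℂ) : ℂ :=
  ![theta1 w1 b x, theta2 w1 b x, theta3 w1 b x, theta4 w1 b x] ν

/-- The half-periods ω₀ = 0, ω₁, ω₂ = −ω₁−ω₃, ω₃. -/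
def om (w1 b : ℂ) (ν : Fin 4) : ℂ := ![0, w1, -w1 - w3 w1 b, w3 w1 b] ν

/-- The lattice point Ω_{m,n} = 2mω₁ + 2nω₃. -/
def lat (w1 b : ℂ) (p : ℤ × ℤ) : ℂ := 2 * (p.1 : ℂ) * w1 + 2 * (p.2 : ℂ) * w3 w1 b

/-- The Weierstrass ℘-function with periods (2ω₁, 2ω₃). -/
def wp (w1 b x : ℂ) : ℂ :=
  1 / x ^ 2 + ∑' p : {p : ℤ × ℤ // p ≠ 0},
    (1 / (x - lat w1 b p.1) ^ 2 - 1 / (lat w1 b p.1) ^ 2)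

/-- The Weierstrass ζ-function with periods (2ω₁, 2ω₃). -/
def wzeta (w1 b x : ℂ) : ℂ :=
  1 / x + ∑' p : {p : ℤ × ℤ // p ≠ 0},
    (1 / (x - lat w1 b p.1) + 1 / lat w1 b p.1 + x / (lat w1 b p.1) ^ 2)

/-- e_ν = ℘(ω_ν). -/
def eW (w1 b : ℂ) (ν : Fin 4) : ℂ := wp w1 b (om w1 b ν)

/-- η₁ = ζ(ω₁). -/
def eta1 (w1 b : ℂ) : ℂ := wzeta w1 b w1

/-- θ′_{ν+1}, the x-derivative. -/
def thetaX (ν : Fin 4) (w1 b x : ℂ) : ℂ := deriv (fun y => theta ν w1 b y) x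

/-- θ̇_{ν+1}, the β-derivative. -/
def thetaB (ν : Fin 4) (w1 b x : ℂ) : ℂ := deriv (fun s => theta ν w1 s x) b

/-- φ_{ν+1} = θ′_{ν+1}/θ_{ν+1}. -/
def phi (ν : Fin 4) (w1 b x : ℂ) : ℂ := thetaX ν w1 b x / theta ν w1 b x

/-- Partial derivative ∂f/∂X_j. -/
def pd {n : ℕ} (f : (Fin n → ℂ) → ℂ) (j : Fin n) (X : Fin n → ℂ) : ℂ :=
  deriv (fun t => f (Function.update X j t)) (X j)

/-- Second partial derivative ∂²f/∂X_j². -/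
def pd2 {n : ℕ} (f : (Fin n → ℂ) → ℂ) (j : Fin n) (X : Fin n → ℂ) : ℂ :=
  deriv (deriv (fun t => f (Function.update X j t))) (X j)

/-- The Inozemtsev Hamiltonian H_N(x; {g_ν}, λ) applied to a function f at x. -/
def Ham (w1 b : ℂ) (N : ℕ) (g : Fin 4 → ℂ) (lam : ℂ)
    (f : (Fin N → ℂ) → ℂ) (x : Fin N → ℂ) : ℂ :=
  (∑ j, (-(pd2 f j x)
      + (∑ ν, g ν * (g ν - 1) * wp w1 b (x j + om w1 b ν)) * f x))
  + (∑ j, ∑ k ∈ Finset.Ioi j,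
      2 * lam * (lam - 1) * (wp w1 b (x j - x k) + wp w1 b (x j + x k))) * f x

/-- Ψ_N(x; {g_ν}, λ) (principal-branch complex powers). -/
def PsiN (w1 b : ℂ) (N : ℕ) (g : Fin 4 → ℂ) (lam : ℂ) (x : Fin N → ℂ) : ℂ :=
  (∏ j, ∏ ν, theta ν w1 b (x j) ^ g ν) *
  ∏ j, ∏ k ∈ Finset.Ioi j,
    (theta1 w1 b (x j - x k) ^ lam * theta1 w1 b (x j + x k) ^ lam)

/-- c₀ = (g₀g₁+g₂g₃)e₁ + (g₀g₂+g₁g₃)e₂ + (g₀g₃+g₁g₂)e₃. -/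
def c0 (w1 b : ℂ) (g : Fin 4 → ℂ) : ℂ :=
  (g 0 * g 1 + g 2 * g 3) * eW w1 b 1 + (g 0 * g 2 + g 1 * g 3) * eW w1 b 2
    + (g 0 * g 3 + g 1 * g 2) * eW w1 b 3

/-- |g| = g₀ + g₁ + g₂ + g₃. -/
def absg (g : Fin 4 → ℂ) : ℂ := g 0 + g 1 + g 2 + g 3

end Paper

namespace Paper

/-- The set {+1, −1} of signs. -/
def pmSet : Finset ℂ := {1, -1}

section Auxiliary

open Filter Topology
open scoped Real

/-- An entire function with periods `π` and `πτ` is constant. -/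
lemma apply_eq_apply_of_doublyPeriodic {h : ℂ → ℂ} (hd : Differentiable ℂ h) {τ : ℂ}
    (hτ : 0 < τ.im) (h1 : ∀ z, h (z + π) = h z) (h2 : ∀ z, h (z + π * τ) = h z) (z w : ℂ) :
    h z = h w := by
  refine hd.apply_eq_apply_of_bounded ?_ z w
  set k : ℝ × ℝ → ℂ := fun p => h (π * (p.1 + p.2 * τ))
  have hk : Continuous k := hd.continuous.comp (by fun_prop)
  have hK : IsCompact (Set.image k (Set.Icc 0 1 ×ˢ Set.Icc 0 1)) :=
    (isCompact_Icc.prod isCompact_Icc).image hk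
  refine hK.isBounded.subset ?_
  rintro _ ⟨u, rfl⟩
  set b : ℝ := (u / π).im / τ.im with hb
  set a : ℝ := (u / π - b * τ).re with ha
  have hu : u / π = a + b * τ := by
    apply Complex.ext
    · simp [ha]
    · simp [hb, hτ.ne']
  refine ⟨(Int.fract a, Int.fract b), ⟨⟨Int.fract_nonneg _, (Int.fract_lt_one _).le⟩,
    Int.fract_nonneg _, (Int.fract_lt_one _).le⟩, ?_⟩
  have e1 := Function.Periodic.sub_zsmul_eq (f := h) (c := (π : ℂ)) (x := u) h1 ⌊a⌋
  have e2 := Function.Periodic.sub_zsmul_eq (f := h) (c := (π * τ : ℂ))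
    (x := u - ⌊a⌋ • (π : ℂ)) h2 ⌊b⌋
  rw [← e1, ← e2]
  simp only [k]
  congr 1
  have hu' : u = π * (a + b * τ) := by
    rw [← hu]; field_simp
  rw [hu', Int.fract, Int.fract]
  push_cast
  simp only [zsmul_eq_mul]
  ring

/-- Two entire functions with the same quasi-periods are proportional if the second has simple
zeros, at which the first vanishes as well. -/
lemma exists_eq_const_mul_of_quasiPeriodic {f g : ℂ → ℂ} (hf : Differentiable ℂ f)
    (hg : Differentiable ℂ g) (hz : ∀ z, g z = 0 → f z = 0 ∧ deriv g z ≠ 0) {τ : ℂ}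
    (hτ : 0 < τ.im) {a e : ℂ → ℂ} (ha : ∀ z, a z ≠ 0) (he : ∀ z, e z ≠ 0)
    (hfa : ∀ z, f (z + π) = a z * f z) (hga : ∀ z, g (z + π) = a z * g z)
    (hfe : ∀ z, f (z + π * τ) = e z * f z) (hge : ∀ z, g (z + π * τ) = e z * g z) :
    ∃ C, ∀ z, f z = C * g z := by
  have hne (z : ℂ) (h0 : g z = 0) : ∀ᶠ w in 𝓝[≠] z, g w ≠ 0 :=
    (hg z).hasDerivAt.eventually_ne (hz z h0).2
  set h : ℂ → ℂ := fun z => if g z = 0 then deriv f z / deriv g z else f z / g z with hh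
  have hmul (z : ℂ) : h z * g z = f z := by
    by_cases h0 : g z = 0
    · simp [h0, (hz z h0).1]
    · simp [hh, h0]
  have hdiff : Differentiable ℂ h := by
    intro z
    by_cases h0 : g z = 0
    · have hd {k : ℂ → ℂ} (hk : Differentiable ℂ k) : DifferentiableAt ℂ (dslope k z) z :=
        ((Complex.differentiableOn_dslope (s := Set.univ) univ_mem).2
          hk.differentiableOn).differentiableAt univ_mem
      have : DifferentiableAt ℂ (fun w => dslope f z w / dslope g z w) z :=
        (hd hf).div (hd hg) (by simpa using (hz z h0).2)
      refine this.congr_of_eventuallyEq ?_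
      filter_upwards [eventually_nhdsWithin_iff.1 (hne z h0)] with w hw
      by_cases hwz : w = z
      · subst hwz; simp [hh, h0]
      · have := hw hwz
        have h1 : w - z ≠ 0 := sub_ne_zero.2 hwz
        simp only [hh, this, if_false, dslope_of_ne _ hwz, slope_def_field, h0, (hz z h0).1,
          sub_zero]
        field_simp
    · refine ((hf z).div (hg z) h0).congr_of_eventuallyEq ?_
      filter_upwards [hg.continuous.continuousAt.eventually_ne h0] with w hw
      simp [hh, hw]
  have hdense : Dense {z | g z ≠ 0} := by
    intro z
    by_cases h0 : g z = 0
    · exact mem_closure_iff_frequently.2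
        (((hne z h0).frequently).filter_mono nhdsWithin_le_nhds)
    · exact subset_closure h0
  have hper {p : ℂ} {c : ℂ → ℂ} (hc : ∀ z, c z ≠ 0) (hfc : ∀ z, f (z + p) = c z * f z)
      (hgc : ∀ z, g (z + p) = c z * g z) (z : ℂ) : h (z + p) = h z := by
    refine congrFun (Continuous.ext_on hdense (f := fun z => h (z + p)) (g := h)
      (hdiff.continuous.comp (by fun_prop)) hdiff.continuous fun w hw => ?_) z
    have h1 := hmul (w + p)
    rw [hfc, hgc, ← hmul w] at h1
    have hw' : g w ≠ 0 := hw
    have : c w * g w ≠ 0 := mul_ne_zero (hc w) hw'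
    apply mul_right_cancel₀ this
    simp only
    rw [h1]; ring
  refine ⟨h 0, fun z => ?_⟩
  rw [← hmul z, apply_eq_apply_of_doublyPeriodic hdiff hτ (hper ha hfa hga) (hper he hfe hge) z 0]

/-- The coefficients `4Qⁿ⁺¹ / (1 - Qⁿ⁺¹)²` of the product expansion of `θ₁`. -/
def prodCoeff (Q : ℂ) (n : ℕ) : ℂ := 4 * Q ^ (n + 1) / (1 - Q ^ (n + 1)) ^ 2

/-- The product `∏ (1 + 4Qⁿ s / (1 - Qⁿ)²)`. -/
def evenProd (Q s : ℂ) : ℂ := ∏' n : ℕ, (1 + prodCoeff Q n * s)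

/-- The product `∏_{n ≥ 1} (1 - Qⁿ w)`. -/
def halfProd (Q w : ℂ) : ℂ := ∏' n : ℕ, (1 + -(Q ^ (n + 1) * w))

section product

variable {Q : ℂ}

lemma one_sub_pow_succ_ne_zero (hQ : ‖Q‖ < 1) (n : ℕ) : 1 - Q ^ (n + 1) ≠ 0 := by
  intro h
  have h1 : ‖Q ^ (n + 1)‖ < 1 := by
    rw [norm_pow]; exact pow_lt_one₀ (norm_nonneg _) hQ (by simp)
  rw [← sub_eq_zero.1 h] at h1
  simp at h1

lemma summable_norm_prodCoeff (hQ : ‖Q‖ < 1) : Summable fun n => ‖prodCoeff Q n‖ := by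
  have hg : Summable fun n : ℕ => 4 * ‖Q‖ ^ (n + 1) / (1 - ‖Q‖) ^ 2 :=
    (((summable_nat_add_iff 1).2
      (summable_geometric_of_lt_one (norm_nonneg _) hQ)).mul_left 4).div_const _
  refine hg.of_nonneg_of_le (fun _ => norm_nonneg _) fun n => ?_
  have h1 : 1 - ‖Q‖ ≤ ‖1 - Q ^ (n + 1)‖ := by
    have h2 : ‖Q‖ ^ (n + 1) ≤ ‖Q‖ := pow_le_of_le_one (norm_nonneg _) hQ.le (by simp)
    have h3 := norm_sub_norm_le (1 : ℂ) (Q ^ (n + 1))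
    rw [norm_one, norm_pow] at h3
    linarith
  have h0 : 0 < 1 - ‖Q‖ := by linarith
  rw [prodCoeff, norm_div, norm_mul, norm_pow, norm_pow]
  simp only [Complex.norm_ofNat]
  gcongr

lemma summable_norm_prodCoeff_mul (hQ : ‖Q‖ < 1) (s : ℂ) :
    Summable fun n => ‖prodCoeff Q n * s‖ := by
  simpa using (summable_norm_prodCoeff hQ).mul_right ‖s‖

lemma multipliableLocallyUniformlyOn_evenProd (hQ : ‖Q‖ < 1) :
    MultipliableLocallyUniformlyOn (fun n s => 1 + prodCoeff Q n * s) Set.univ := by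
  use evenProd Q
  apply hasProdLocallyUniformlyOn_of_forall_compact isOpen_univ
  intro K _ hK
  obtain ⟨r, hr⟩ := hK.isBounded.exists_norm_le
  refine ((summable_norm_prodCoeff hQ).mul_right r).hasProdUniformlyOn_nat_one_add hK
    (.of_forall fun n s hs => ?_) fun _ => by fun_prop
  rw [norm_mul]
  gcongr
  exact hr s hs

lemma differentiable_evenProd (hQ : ‖Q‖ < 1) : Differentiable ℂ (evenProd Q) := by
  rw [← differentiableOn_univ]
  exact (multipliableLocallyUniformlyOn_evenProd hQ).hasProdLocallyUniformlyOn.differentiableOn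
    (.of_forall fun _ ↦ by simpa [Finset.prod_fn] using
      DifferentiableOn.finsetProd (fun _ _ ↦ by fun_prop)) isOpen_univ

@[simp] lemma evenProd_zero : evenProd Q 0 = 1 := by simp [evenProd]

lemma deriv_evenProd_zero (hQ : ‖Q‖ < 1) : deriv (evenProd Q) 0 = ∑' n, prodCoeff Q n := by
  have hl (n : ℕ) : logDeriv (fun s => 1 + prodCoeff Q n * s) 0 = prodCoeff Q n := by
    simp [logDeriv]
  have := logDeriv_tprod_eq_tsum isOpen_univ (Set.mem_univ (0 : ℂ))
    (f := fun n s => 1 + prodCoeff Q n * s) (by simp) (fun _ => by fun_prop)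
    (by simpa only [hl] using (summable_norm_prodCoeff hQ).of_norm)
    (multipliableLocallyUniformlyOn_evenProd hQ) (by simp)
  simp only [hl] at this
  rw [← this]
  change _ = logDeriv (evenProd Q) 0
  simp [logDeriv]

lemma evenProd_eq_zero (hQ : ‖Q‖ < 1) {s : ℂ} (h : evenProd Q s = 0) :
    ∃ n, 1 + prodCoeff Q n * s = 0 := by
  by_contra! hn
  exact tprod_one_add_ne_zero_of_summable hn (summable_norm_prodCoeff_mul hQ s) h

lemma summable_norm_halfProd (hQ : ‖Q‖ < 1) (w : ℂ) :
    Summable fun n : ℕ => ‖-(Q ^ (n + 1) * w)‖ := by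
  simpa using ((summable_nat_add_iff 1).2
    (summable_geometric_of_lt_one (norm_nonneg _) hQ)).mul_right ‖w‖

lemma halfProd_eq_mul (hQ : ‖Q‖ < 1) (w : ℂ) :
    halfProd Q w = (1 - Q * w) * halfProd Q (Q * w) := by
  rw [halfProd, tprod_eq_zero_mul' ?_]
  · simp only [halfProd]
    congr 1
    · ring
    · refine tprod_congr fun n => ?_
      ring
  · refine (multipliable_one_add_of_summable (summable_norm_halfProd hQ (Q * w))).congr fun n => ?_
    ring

lemma halfProd_one_ne_zero (hQ : ‖Q‖ < 1) : halfProd Q 1 ≠ 0 :=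
  tprod_one_add_ne_zero_of_summable
    (fun n => by simpa [← sub_eq_add_neg] using one_sub_pow_succ_ne_zero hQ n)
    (summable_norm_halfProd hQ 1)

lemma one_add_prodCoeff_mul_sin_sq (hQ : ‖Q‖ < 1) (n : ℕ) (z : ℂ) :
    (1 - Q ^ (n + 1)) ^ 2 * (1 + prodCoeff Q n * sin z ^ 2) =
      (1 - Q ^ (n + 1) * exp (2 * I * z)) * (1 - Q ^ (n + 1) * exp (-(2 * I * z))) := by
  have h := one_sub_pow_succ_ne_zero hQ n
  have h1 : sin z ^ 2 = (2 - exp (2 * I * z) - exp (-(2 * I * z))) / 4 := by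
    have e1 : exp (2 * I * z) = exp (z * I) ^ 2 := by rw [← exp_nat_mul]; congr 1; push_cast; ring
    have e2 : exp (-(2 * I * z)) = exp (-z * I) ^ 2 := by
      rw [← exp_nat_mul]; congr 1; push_cast; ring
    have e3 : exp (-z * I) * exp (z * I) = 1 := by rw [← exp_add]; simp
    rw [e1, e2, sin]
    linear_combination (exp (-z * I) - exp (z * I)) ^ 2 / 4 * I_sq + e3 / 2
  have h2 : exp (2 * I * z) * exp (-(2 * I * z)) = 1 := by rw [← exp_add]; simp
  rw [prodCoeff, h1]
  field_simp
  linear_combination (-(Q ^ (n + 1)) ^ 2) * h2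

lemma halfProd_mul_halfProd (hQ : ‖Q‖ < 1) (z : ℂ) :
    halfProd Q (exp (2 * I * z)) * halfProd Q (exp (-(2 * I * z))) =
      halfProd Q 1 ^ 2 * evenProd Q (sin z ^ 2) := by
  have hm (w : ℂ) := multipliable_one_add_of_summable (summable_norm_halfProd hQ w)
  have hB := multipliable_one_add_of_summable (summable_norm_prodCoeff_mul hQ (sin z ^ 2))
  rw [pow_two, halfProd, halfProd, halfProd, evenProd, ← (hm _).tprod_mul (hm _),
    ← (hm _).tprod_mul (hm _), ← ((hm _).mul (hm _)).tprod_mul hB]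
  refine tprod_congr fun n => ?_
  have := one_add_prodCoeff_mul_sin_sq hQ n z
  linear_combination -this

end product

lemma differentiable_deriv_of_differentiable {f : ℂ → ℂ} (hf : Differentiable ℂ f) :
    Differentiable ℂ (deriv f) := by
  rw [← differentiableOn_univ] at hf ⊢
  exact hf.deriv isOpen_univ

/-- The function `sin z ∏ (1 + 4Qⁿ sin² z / (1 - Qⁿ)²)` with `Q = exp (2πiτ)`, which is
`θ₁` normalised to have derivative `1` at the origin. -/
def sigmaProd (τ z : ℂ) : ℂ := sin z * evenProd (exp (2 * π * I * τ)) (sin z ^ 2)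

/-- The factor acquired by `θ₁` under translation by `πτ`. -/
def thetaFactor (τ z : ℂ) : ℂ := -exp (-(π * I * τ) - 2 * I * z)

lemma thetaFactor_ne_zero (τ z : ℂ) : thetaFactor τ z ≠ 0 := neg_ne_zero.2 (exp_ne_zero _)

lemma hasDerivAt_thetaFactor (τ z : ℂ) :
    HasDerivAt (thetaFactor τ) (-2 * I * thetaFactor τ z) z := by
  have h := (((hasDerivAt_id z).const_mul (2 * I)).const_sub (-(π * I * τ))).cexp.neg
  convert! h using 1
  simp [thetaFactor]
  ring

section sigmaProd

variable {τ : ℂ}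

lemma norm_exp_lt_one (hτ : 0 < τ.im) : ‖exp (2 * π * I * τ)‖ < 1 := by
  rw [norm_exp]
  have : (2 * π * I * τ).re = -(2 * π * τ.im) := by simp
  rw [this, Real.exp_lt_one_iff]
  have := Real.pi_pos
  have : 0 < 2 * π * τ.im := by positivity
  linarith

lemma differentiable_sigmaProd (hτ : 0 < τ.im) : Differentiable ℂ (sigmaProd τ) :=
  differentiable_sin.mul ((differentiable_evenProd (norm_exp_lt_one hτ)).comp
    (differentiable_sin.pow 2))

lemma sigmaProd_neg (z : ℂ) : sigmaProd τ (-z) = -sigmaProd τ z := by simp [sigmaProd]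

@[simp] lemma sigmaProd_zero : sigmaProd τ 0 = 0 := by simp [sigmaProd]

lemma sigmaProd_add_pi (z : ℂ) : sigmaProd τ (z + π) = -1 * sigmaProd τ z := by
  simp [sigmaProd, sin_add_pi]

lemma halfProd_sq_mul_sigmaProd (hτ : 0 < τ.im) (z : ℂ) :
    halfProd (exp (2 * π * I * τ)) 1 ^ 2 * sigmaProd τ z =
      sin z * (halfProd (exp (2 * π * I * τ)) (exp (2 * I * z)) *
        halfProd (exp (2 * π * I * τ)) (exp (-(2 * I * z)))) := by
  rw [halfProd_mul_halfProd (norm_exp_lt_one hτ), sigmaProd]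
  ring

lemma sigmaProd_add_pi_mul (hτ : 0 < τ.im) (z : ℂ) :
    sigmaProd τ (z + π * τ) = thetaFactor τ z * sigmaProd τ z := by
  have hQ := norm_exp_lt_one hτ
  apply mul_left_cancel₀ (pow_ne_zero 2 (halfProd_one_ne_zero hQ))
  rw [mul_left_comm, halfProd_sq_mul_sigmaProd hτ, halfProd_sq_mul_sigmaProd hτ]
  set Q := exp (2 * π * I * τ) with hQdef
  have e1 : exp (2 * I * (z + π * τ)) = Q * exp (2 * I * z) := by
    rw [hQdef, ← exp_add]; congr 1; ring
  have e2 : exp (-(2 * I * z)) = Q * exp (-(2 * I * (z + π * τ))) := by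
    rw [hQdef, ← exp_add]; congr 1; ring
  have e3 := halfProd_eq_mul hQ (exp (2 * I * z))
  have e4 := halfProd_eq_mul hQ (exp (-(2 * I * (z + π * τ))))
  rw [← e2] at e4
  rw [e1, e4, e3]
  have e5 : sin (z + π * τ) * (1 - exp (-(2 * I * z))) =
      thetaFactor τ z * sin z * (1 - Q * exp (2 * I * z)) := by
    have f1 : Q = exp (π * I * τ) ^ 2 := by
      rw [hQdef, ← exp_nat_mul]; congr 1; push_cast; ring
    have f2 : exp (2 * I * z) = exp (I * z) ^ 2 := by
      rw [← exp_nat_mul]; congr 1; push_cast; ring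
    have f3 : exp (-(2 * I * z)) = (exp (I * z))⁻¹ ^ 2 := by
      rw [← exp_neg, ← exp_nat_mul]; congr 1; push_cast; ring
    have f4 : exp ((z + π * τ) * I) = exp (I * z) * exp (π * I * τ) := by
      rw [← exp_add]; congr 1; ring
    have f5 : exp (-(z + π * τ) * I) = (exp (I * z))⁻¹ * (exp (π * I * τ))⁻¹ := by
      rw [← exp_neg, ← exp_neg, ← exp_add]; congr 1; ring
    have f6 : exp (-(π * I * τ) - 2 * I * z) = (exp (π * I * τ))⁻¹ * (exp (I * z))⁻¹ ^ 2 := by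
      rw [sub_eq_add_neg, exp_add, f3, exp_neg]
    have f7 : exp (z * I) = exp (I * z) := by rw [mul_comm]
    have f8 : exp (-z * I) = (exp (I * z))⁻¹ := by rw [← exp_neg]; congr 1; ring
    rw [thetaFactor, sin, sin, f3, f4, f5, f6, f7, f8, f1, f2]
    have := exp_ne_zero (I * z)
    have := exp_ne_zero (π * I * τ)
    field_simp
    ring
  linear_combination e5 * halfProd Q (Q * exp (2 * I * z)) * halfProd Q (exp (-(2 * I * z)))

lemma hasDerivAt_sigmaProd (hτ : 0 < τ.im) (z : ℂ) :
    HasDerivAt (sigmaProd τ) (cos z * (evenProd (exp (2 * π * I * τ)) (sin z ^ 2) +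
      2 * sin z ^ 2 * deriv (evenProd (exp (2 * π * I * τ))) (sin z ^ 2))) z := by
  have hB := differentiable_evenProd (norm_exp_lt_one hτ)
  have h := (hasDerivAt_sin z).mul ((hB (sin z ^ 2)).hasDerivAt.comp z ((hasDerivAt_sin z).pow 2))
  convert! h using 1
  push_cast
  simp
  ring

lemma deriv_sigmaProd_zero (hτ : 0 < τ.im) : deriv (sigmaProd τ) 0 = 1 := by
  simp [(hasDerivAt_sigmaProd hτ 0).deriv]

lemma deriv_deriv_deriv_sigmaProd_zero (hτ : 0 < τ.im) :
    deriv (deriv (deriv (sigmaProd τ))) 0 =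
      -1 + 6 * ∑' n, prodCoeff (exp (2 * π * I * τ)) n := by
  have hB := differentiable_evenProd (norm_exp_lt_one hτ)
  rw [← deriv_evenProd_zero (norm_exp_lt_one hτ)]
  set B := evenProd (exp (2 * π * I * τ)) with hBdef
  have hB1 := differentiable_deriv_of_differentiable hB
  set C : ℂ → ℂ := fun s => B s + 2 * s * deriv B s with hC
  have hC0 : Differentiable ℂ C := by fun_prop
  have hC1 := differentiable_deriv_of_differentiable hC0
  have hCd : deriv C 0 = 3 * deriv B 0 := by
    have := (hB 0).hasDerivAt.add
      (((hasDerivAt_id (0 : ℂ)).const_mul 2).mul (hB1 0).hasDerivAt)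
    have := this.deriv
    simp only [id, mul_zero, zero_mul, add_zero, mul_one] at this
    exact this.trans (by ring)
  have e1 : deriv (sigmaProd τ) = fun z => cos z * C (sin z ^ 2) :=
    funext fun z => (hasDerivAt_sigmaProd hτ z).deriv
  set E : ℂ → ℂ := fun z => -C (sin z ^ 2) + 2 * cos z ^ 2 * deriv C (sin z ^ 2) with hE
  have hE0 : Differentiable ℂ E := by fun_prop
  have e2 : deriv (fun z => cos z * C (sin z ^ 2)) = fun z => sin z * E z := by
    funext z
    have h := (hasDerivAt_cos z).mul
      ((hC0 (sin z ^ 2)).hasDerivAt.comp z ((hasDerivAt_sin z).pow 2))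
    have := h.deriv
    refine this.trans ?_
    simp [hE]
    ring
  rw [e1, e2]
  have h := ((hasDerivAt_sin 0).mul (hE0 0).hasDerivAt).deriv
  refine h.trans ?_
  simp [hE, hCd]
  simp [hC, hBdef]
  ring

lemma exists_eq_of_sigmaProd_eq_zero (hτ : 0 < τ.im) {z : ℂ} (h : sigmaProd τ z = 0) :
    ∃ m n : ℤ, z = m * π + n * (π * τ) := by
  have hQ := norm_exp_lt_one hτ
  rcases mul_eq_zero.1 h with h | h
  · obtain ⟨k, hk⟩ := sin_eq_zero_iff.1 h
    exact ⟨k, 0, by simp [hk]⟩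
  · obtain ⟨n, hn⟩ := evenProd_eq_zero hQ h
    have h1 := one_add_prodCoeff_mul_sin_sq hQ n z
    rw [hn, mul_zero, ← exp_nat_mul, ← exp_add, ← exp_add] at h1
    rcases mul_eq_zero.1 h1.symm with h1 | h1
    · obtain ⟨k, hk⟩ := exp_eq_one_iff.1 (sub_eq_zero.1 h1).symm
      refine ⟨k, -(n + 1), ?_⟩
      apply mul_left_cancel₀ (mul_ne_zero two_ne_zero I_ne_zero)
      push_cast at hk ⊢
      linear_combination hk
    · obtain ⟨k, hk⟩ := exp_eq_one_iff.1 (sub_eq_zero.1 h1).symm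
      refine ⟨-k, n + 1, ?_⟩
      apply mul_left_cancel₀ (mul_ne_zero two_ne_zero I_ne_zero)
      push_cast at hk ⊢
      linear_combination -hk

/-- A property stable under translations by `π` and `πτ` that holds at `a` holds at `z` whenever
`σ(z - a) = 0`. -/
lemma of_sigmaProd_sub_eq_zero (hτ : 0 < τ.im) {p : ℂ → Prop} (h1 : ∀ z, p (z + π) ↔ p z)
    (h2 : ∀ z, p (z + π * τ) ↔ p z) {a z : ℂ} (ha : p a) (hz : sigmaProd τ (z - a) = 0) : p z := by
  obtain ⟨m, n, h⟩ := exists_eq_of_sigmaProd_eq_zero hτ hz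
  have e1 : Function.Periodic p (π : ℂ) := fun z => propext (h1 z)
  have e2 : Function.Periodic p (π * τ : ℂ) := fun z => propext (h2 z)
  have hz' : z = a + m • (π : ℂ) + n • (π * τ : ℂ) := by
    simp only [zsmul_eq_mul]; linear_combination h
  rw [hz', e2.zsmul n, e1.zsmul m]
  exact ha

lemma deriv_sigmaProd_neg (z : ℂ) : deriv (sigmaProd τ) (-z) = deriv (sigmaProd τ) z := by
  have h := deriv_comp_neg (f := sigmaProd τ) (x := z)
  have e : (fun x => sigmaProd τ (-x)) = fun x => -sigmaProd τ x := funext sigmaProd_neg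
  rw [e, deriv.fun_neg] at h
  exact (neg_injective h).symm

lemma deriv_deriv_sigmaProd_neg (z : ℂ) :
    deriv (deriv (sigmaProd τ)) (-z) = -deriv (deriv (sigmaProd τ)) z := by
  have h := deriv_comp_neg (f := deriv (sigmaProd τ)) (x := z)
  have e : (fun x => deriv (sigmaProd τ) (-x)) = fun x => deriv (sigmaProd τ) x :=
    funext deriv_sigmaProd_neg
  rw [e] at h
  rw [h, neg_neg]

lemma deriv_sigmaProd_add_pi (z : ℂ) :
    deriv (sigmaProd τ) (z + π) = -1 * deriv (sigmaProd τ) z := by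
  rw [← deriv_comp_add_const, funext sigmaProd_add_pi, deriv_const_mul_field]

lemma deriv_deriv_sigmaProd_add_pi (z : ℂ) :
    deriv (deriv (sigmaProd τ)) (z + π) = -1 * deriv (deriv (sigmaProd τ)) z := by
  rw [← deriv_comp_add_const, funext deriv_sigmaProd_add_pi, deriv_const_mul_field]

lemma deriv_sigmaProd_add_pi_mul (hτ : 0 < τ.im) (z : ℂ) :
    deriv (sigmaProd τ) (z + π * τ) =
      thetaFactor τ z * (deriv (sigmaProd τ) z - 2 * I * sigmaProd τ z) := by
  rw [← deriv_comp_add_const, funext (sigmaProd_add_pi_mul hτ)]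
  refine ((hasDerivAt_thetaFactor τ z).mul
    (differentiable_sigmaProd hτ z).hasDerivAt).deriv.trans ?_
  ring

lemma deriv_deriv_sigmaProd_add_pi_mul (hτ : 0 < τ.im) (z : ℂ) :
    deriv (deriv (sigmaProd τ)) (z + π * τ) = thetaFactor τ z * (deriv (deriv (sigmaProd τ)) z
      - 4 * I * deriv (sigmaProd τ) z - 4 * sigmaProd τ z) := by
  have hd := differentiable_sigmaProd hτ
  rw [← deriv_comp_add_const, funext (deriv_sigmaProd_add_pi_mul hτ)]
  refine ((hasDerivAt_thetaFactor τ z).mul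
    ((differentiable_deriv_of_differentiable hd z).hasDerivAt.sub
      ((hd z).hasDerivAt.const_mul (2 * I)))).deriv.trans ?_
  simp only [Pi.sub_apply]
  linear_combination 4 * thetaFactor τ z * sigmaProd τ z * I_sq

lemma deriv_sigmaProd_ne_zero (hτ : 0 < τ.im) {z : ℂ} (hz : sigmaProd τ z = 0) :
    deriv (sigmaProd τ) z ≠ 0 := by
  refine (of_sigmaProd_sub_eq_zero hτ
    (p := fun z => sigmaProd τ z = 0 ∧ deriv (sigmaProd τ) z ≠ 0) (fun z => ?_) (fun z => ?_)
    (a := 0) ?_ (by simpa using hz)).2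
  · rw [sigmaProd_add_pi, deriv_sigmaProd_add_pi]; simp
  · rw [sigmaProd_add_pi_mul hτ, deriv_sigmaProd_add_pi_mul hτ]
    simp +contextual [thetaFactor_ne_zero]
  · simp [deriv_sigmaProd_zero hτ]

/-- An odd entire function with the quasi-periods of `θ₁` is a multiple of the product. -/
lemma exists_eq_const_mul_sigmaProd (hτ : 0 < τ.im) {f : ℂ → ℂ} (hf : Differentiable ℂ f)
    (h0 : f 0 = 0) (h1 : ∀ z, f (z + π) = -1 * f z)
    (h2 : ∀ z, f (z + π * τ) = thetaFactor τ z * f z) : ∃ C, ∀ z, f z = C * sigmaProd τ z := by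
  refine exists_eq_const_mul_of_quasiPeriodic hf (differentiable_sigmaProd hτ)
    (fun z hz => ⟨?_, deriv_sigmaProd_ne_zero hτ hz⟩) hτ (a := fun _ => -1) (by simp)
    (thetaFactor_ne_zero τ) h1 sigmaProd_add_pi h2 (sigmaProd_add_pi_mul hτ)
  refine of_sigmaProd_sub_eq_zero hτ (p := fun z => f z = 0) (fun z => ?_) (fun z => ?_) h0
    (by simpa using hz)
  · simp [h1]
  · simp [h2, thetaFactor_ne_zero]

/-- The second derivative at `t = 0` of `-σ(u + t) σ(v + t) σ(t - u - v)` is a multiple of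
`σ(u) σ(v) σ(u + v)`. -/
lemma sigmaProd_three_term (hτ : 0 < τ.im) (u : ℂ) {v : ℂ} (hv : sigmaProd τ v ≠ 0) :
    deriv (deriv (sigmaProd τ)) u * sigmaProd τ v * sigmaProd τ (u + v)
      + sigmaProd τ u * deriv (deriv (sigmaProd τ)) v * sigmaProd τ (u + v)
      + sigmaProd τ u * sigmaProd τ v * deriv (deriv (sigmaProd τ)) (u + v)
      + 2 * (deriv (sigmaProd τ) u * deriv (sigmaProd τ) v * sigmaProd τ (u + v)
        - sigmaProd τ u * deriv (sigmaProd τ) v * deriv (sigmaProd τ) (u + v)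
        - deriv (sigmaProd τ) u * sigmaProd τ v * deriv (sigmaProd τ) (u + v))
      = deriv (deriv (deriv (sigmaProd τ))) 0 *
        (sigmaProd τ u * sigmaProd τ v * sigmaProd τ (u + v)) := by
  have hP := differentiable_sigmaProd hτ
  have hP1 := differentiable_deriv_of_differentiable hP
  have hP2 := differentiable_deriv_of_differentiable hP1
  have hdd0 : deriv (deriv (sigmaProd τ)) 0 = 0 := by
    have := deriv_deriv_sigmaProd_neg (τ := τ) 0
    rw [neg_zero] at this
    exact self_eq_neg.1 this
  set H : ℂ → ℂ := fun u => deriv (deriv (sigmaProd τ)) u * sigmaProd τ v * sigmaProd τ (u + v)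
      + sigmaProd τ u * deriv (deriv (sigmaProd τ)) v * sigmaProd τ (u + v)
      + sigmaProd τ u * sigmaProd τ v * deriv (deriv (sigmaProd τ)) (u + v)
      + 2 * (deriv (sigmaProd τ) u * deriv (sigmaProd τ) v * sigmaProd τ (u + v)
        - sigmaProd τ u * deriv (sigmaProd τ) v * deriv (sigmaProd τ) (u + v)
        - deriv (sigmaProd τ) u * sigmaProd τ v * deriv (sigmaProd τ) (u + v)) with hH
  set g : ℂ → ℂ := fun u => sigmaProd τ u * sigmaProd τ v * sigmaProd τ (u + v) with hg
  have hHd : Differentiable ℂ H := by fun_prop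
  have hgd : Differentiable ℂ g := by fun_prop
  have hH1 (z : ℂ) : H (z + π) = 1 * H z := by
    simp only [hH, add_right_comm z (π : ℂ) v, sigmaProd_add_pi, deriv_sigmaProd_add_pi,
      deriv_deriv_sigmaProd_add_pi]
    ring
  have hg1 (z : ℂ) : g (z + π) = 1 * g z := by
    simp only [hg, add_right_comm z (π : ℂ) v, sigmaProd_add_pi]
    ring
  have hH2 (z : ℂ) : H (z + π * τ) = thetaFactor τ z * thetaFactor τ (z + v) * H z := by
    simp only [hH, add_right_comm z (π * τ : ℂ) v, sigmaProd_add_pi_mul hτ,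
      deriv_sigmaProd_add_pi_mul hτ, deriv_deriv_sigmaProd_add_pi_mul hτ]
    linear_combination
      -8 * thetaFactor τ z * thetaFactor τ (z + v) * sigmaProd τ z * sigmaProd τ v *
      sigmaProd τ (z + v) * I_sq
  have hg2 (z : ℂ) : g (z + π * τ) = thetaFactor τ z * thetaFactor τ (z + v) * g z := by
    simp only [hg, add_right_comm z (π * τ : ℂ) v, sigmaProd_add_pi_mul hτ]
    ring
  have hne (z : ℂ) : thetaFactor τ z * thetaFactor τ (z + v) ≠ 0 :=
    mul_ne_zero (thetaFactor_ne_zero _ _) (thetaFactor_ne_zero _ _)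
  have hH0 : H 0 = 0 := by simp [hH, hdd0]; ring
  have hHv : H (-v) = 0 := by
    simp only [hH, deriv_deriv_sigmaProd_neg, deriv_sigmaProd_neg, sigmaProd_neg, neg_add_cancel,
      sigmaProd_zero, hdd0]
    ring
  have hHz {a z : ℂ} (ha : H a = 0) (hz : sigmaProd τ (z - a) = 0) : H z = 0 := by
    refine of_sigmaProd_sub_eq_zero hτ (p := fun z => H z = 0) (fun z => ?_) (fun z => ?_) ha hz
    · simp [hH1]
    · rw [hH2, mul_eq_zero_iff_left (hne z)]
  have hgderiv (z : ℂ) : deriv g z = deriv (sigmaProd τ) z * sigmaProd τ v * sigmaProd τ (z + v)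
      + sigmaProd τ z * sigmaProd τ v * deriv (sigmaProd τ) (z + v) :=
    (((hP z).hasDerivAt.mul_const _).mul ((hP (z + v)).hasDerivAt.comp_add_const z v)).deriv
  -- the zeros of `u ↦ σ(u)` and `u ↦ σ(u + v)` are disjoint because `σ(v) ≠ 0`
  have hpv {z : ℂ} (hz : sigmaProd τ z = 0) : sigmaProd τ (z + v) ≠ 0 := by
    refine of_sigmaProd_sub_eq_zero hτ (p := fun z => sigmaProd τ (z + v) ≠ 0)
      (fun z => ?_) (fun z => ?_) (a := 0) (by simpa using hv) (by simpa using hz)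
    · rw [add_right_comm, sigmaProd_add_pi]; simp
    · rw [add_right_comm, sigmaProd_add_pi_mul hτ]; simp [thetaFactor_ne_zero]
  obtain ⟨C, hC⟩ := exists_eq_const_mul_of_quasiPeriodic hHd hgd (fun z hz => by
    rw [hgderiv]
    rcases mul_eq_zero.1 hz with hz | hz
    · have hz := (mul_eq_zero.1 hz).resolve_right hv
      refine ⟨hHz hH0 (by simpa using hz), ?_⟩
      rw [hz]
      simpa using ⟨⟨deriv_sigmaProd_ne_zero hτ hz, hv⟩, hpv hz⟩
    · refine ⟨hHz hHv (by simpa using hz), ?_⟩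
      have hz' : sigmaProd τ z ≠ 0 := fun h => hpv h hz
      rw [hz]
      simpa using ⟨⟨hz', hv⟩, deriv_sigmaProd_ne_zero hτ hz⟩)
    hτ (a := fun _ => 1) (by simp) hne hH1 hg1 hH2 hg2
  have hHderiv : deriv H 0 = deriv (deriv (deriv (sigmaProd τ))) 0 * sigmaProd τ v ^ 2 := by
    have k0 := (hP 0).hasDerivAt
    have k1 := (hP1 0).hasDerivAt
    have k2 := (hP2 0).hasDerivAt
    have l0 := (hP (0 + v)).hasDerivAt.comp_add_const 0 v
    have l1 := (hP1 (0 + v)).hasDerivAt.comp_add_const 0 v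
    have l2 := (hP2 (0 + v)).hasDerivAt.comp_add_const 0 v
    refine HasDerivAt.deriv ?_
    convert! ((((k2.mul_const (sigmaProd τ v)).mul l0).add
      ((k0.mul_const (deriv (deriv (sigmaProd τ)) v)).mul l0)).add
      ((k0.mul_const (sigmaProd τ v)).mul l2)).add
      (((((k1.mul_const (deriv (sigmaProd τ) v)).mul l0).sub
        ((k0.mul_const (deriv (sigmaProd τ) v)).mul l1)).sub
        ((k1.mul_const (sigmaProd τ v)).mul l1)).const_mul 2) using 1
    rw [zero_add, hdd0, sigmaProd_zero, deriv_sigmaProd_zero hτ]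
    ring
  have hCval : C = deriv (deriv (deriv (sigmaProd τ))) 0 := by
    have e : H = fun z => C * g z := funext hC
    rw [e, deriv_const_mul_field, hgderiv, zero_add, deriv_sigmaProd_zero hτ,
      sigmaProd_zero] at hHderiv
    apply mul_right_cancel₀ (pow_ne_zero 2 hv)
    linear_combination hHderiv
  rw [← hCval]
  exact hC u

end sigmaProd

/-- The general term of the sine series of `θ₁`, with `sin` replaced by `g`. -/
def sineTerm (g : ℂ → ℂ) (k n : ℕ) (τ z : ℂ) : ℂ :=
  (-1) ^ n * exp (π * I * τ * ((n : ℂ) + 1 / 2) ^ 2) * ((2 * (n : ℂ) + 1) ^ k * g ((2 * n + 1) * z))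

/-- The first Jacobi theta function in the variables `τ` and `z`, with quasi-periods `π`
and `π * τ`. -/
def thetaSum (τ z : ℂ) : ℂ := 2 * ∑' n : ℕ, sineTerm sin 0 n τ z

lemma summable_exp_neg_sq (S : ℝ) {T : ℝ} (hT : 0 < T) :
    Summable fun n : ℕ => Real.exp (-(π * T) * n ^ 2 + (2 * n + 1) * S) := by
  have h := (summable_pow_mul_jacobiTheta₂_term_bound (S / π) hT 0).comp_injective
    (Nat.cast_injective (R := ℤ))
  refine (h.mul_left (Real.exp S)).congr fun n => ?_
  simp only [Function.comp, pow_zero, one_mul, ← Real.exp_add]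
  congr 1
  have : |((n : ℤ) : ℝ)| = n := by simp
  push_cast at this ⊢
  rw [this]
  field_simp
  ring

lemma norm_sineTerm_le {g : ℂ → ℂ} (hg : ∀ w, ‖g w‖ ≤ Real.exp |w.im|) (k n : ℕ) {S T : ℝ}
    (hT : 0 < T) {τ z : ℂ} (hτ : T ≤ τ.im) (hz : |z.im| ≤ S) :
    ‖sineTerm g k n τ z‖ ≤ Real.exp (-(π * T) * n ^ 2 + (2 * n + 1) * (S + k)) := by
  have h1 : ‖exp (π * I * τ * ((n : ℂ) + 1 / 2) ^ 2)‖ ≤ Real.exp (-(π * T) * n ^ 2) := by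
    rw [norm_exp]
    have : (π * I * τ * ((n : ℂ) + 1 / 2) ^ 2).re = -(π * τ.im) * ((n : ℝ) + 1 / 2) ^ 2 := by
      have : π * I * τ * ((n : ℂ) + 1 / 2) ^ 2 =
          ((π * ((n : ℝ) + 1 / 2) ^ 2 : ℝ) : ℂ) * (I * τ) := by
        push_cast; ring
      rw [this, re_ofReal_mul]
      simp
      ring
    rw [this, Real.exp_le_exp]
    have h2 : π * T ≤ π * τ.im := mul_le_mul_of_nonneg_left hτ Real.pi_pos.le
    have h3 : (n : ℝ) ^ 2 ≤ ((n : ℝ) + 1 / 2) ^ 2 := by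
      have : (0 : ℝ) ≤ n := n.cast_nonneg
      nlinarith
    have h4 : 0 ≤ π * τ.im := (mul_pos Real.pi_pos hT).le.trans h2
    nlinarith [mul_le_mul h2 h3 (by positivity) h4]
  have h2 : ‖(2 * (n : ℂ) + 1) ^ k‖ ≤ Real.exp ((2 * n + 1) * k) := by
    rw [norm_pow, show (2 * (n : ℂ) + 1) = ((2 * n + 1 : ℝ) : ℂ) by push_cast; rfl, norm_real,
      Real.norm_of_nonneg (by positivity), mul_comm _ (k : ℝ), Real.exp_nat_mul]
    exact pow_le_pow_left₀ (by positivity) ((lt_add_one _).le.trans (Real.add_one_le_exp _)) _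
  have h3 : ‖g ((2 * n + 1) * z)‖ ≤ Real.exp ((2 * n + 1) * S) := by
    refine (hg _).trans (Real.exp_le_exp.2 ?_)
    rw [show (2 * (n : ℂ) + 1) = ((2 * n + 1 : ℝ) : ℂ) by push_cast; rfl, im_ofReal_mul, abs_mul,
      abs_of_nonneg (by positivity : (0 : ℝ) ≤ 2 * n + 1)]
    gcongr
  rw [sineTerm, norm_mul, norm_mul, norm_mul, norm_pow, norm_neg, norm_one, one_pow, one_mul]
  calc _ ≤ Real.exp (-(π * T) * n ^ 2) *
        (Real.exp ((2 * n + 1) * k) * Real.exp ((2 * n + 1) * S)) := by gcongr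
    _ = _ := by
      rw [← Real.exp_add, ← Real.exp_add]
      congr 1
      ring

lemma norm_sin_le_exp (w : ℂ) : ‖sin w‖ ≤ Real.exp |w.im| := by
  have h1 : ‖exp (w * I)‖ ≤ Real.exp |w.im| := by
    rw [norm_exp, Real.exp_le_exp]; simpa using neg_le_abs _
  have h2 : ‖exp (-w * I)‖ ≤ Real.exp |w.im| := by
    rw [norm_exp, Real.exp_le_exp]; simpa using le_abs_self _
  rw [sin, norm_div, norm_mul, norm_I, mul_one, RCLike.norm_ofNat]
  linarith [norm_sub_le (exp (-w * I)) (exp (w * I))]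

lemma norm_cos_le_exp (w : ℂ) : ‖cos w‖ ≤ Real.exp |w.im| := by
  have h1 : ‖exp (w * I)‖ ≤ Real.exp |w.im| := by
    rw [norm_exp, Real.exp_le_exp]; simpa using neg_le_abs _
  have h2 : ‖exp (-w * I)‖ ≤ Real.exp |w.im| := by
    rw [norm_exp, Real.exp_le_exp]; simpa using le_abs_self _
  rw [cos, norm_div, RCLike.norm_ofNat]
  linarith [norm_add_le (exp (w * I)) (exp (-w * I))]

lemma hasDerivAt_sineTerm {g g' : ℂ → ℂ} (hg : ∀ w, HasDerivAt g (g' w) w) (k n : ℕ) (τ z : ℂ) :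
    HasDerivAt (sineTerm g k n τ) (sineTerm g' (k + 1) n τ z) z := by
  unfold sineTerm
  have h := (((hg ((2 * n + 1) * z)).comp z
    ((hasDerivAt_id z).const_mul (2 * (n : ℂ) + 1))).const_mul ((2 * (n : ℂ) + 1) ^ k)).const_mul ((-1) ^ n * exp (π * I * τ * ((n : ℂ) + 1 / 2) ^ 2))
  refine h.congr_deriv ?_
  ring

/-- Termwise differentiation in the variable `z`. -/
lemma hasDerivAt_tsum_sineTerm {g g' : ℂ → ℂ} (hg : ∀ w, HasDerivAt g (g' w) w)
    (hb : ∀ w, ‖g w‖ ≤ Real.exp |w.im|) (k : ℕ) {τ : ℂ} (hτ : 0 < τ.im) (z : ℂ) :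
    HasDerivAt (fun z => ∑' n : ℕ, sineTerm g k n τ z) (∑' n : ℕ, sineTerm g' (k + 1) n τ z) z := by
  have hU : IsOpen {z' : ℂ | |z'.im| < |z.im| + 1} :=
    isOpen_lt (continuous_abs.comp continuous_im) continuous_const
  have hz : z ∈ {z' : ℂ | |z'.im| < |z.im| + 1} := lt_add_one |z.im|
  have hu := summable_exp_neg_sq (|z.im| + 1 + k) hτ
  have hd : ∀ n, DifferentiableOn ℂ (sineTerm g k n τ) {z' : ℂ | |z'.im| < |z.im| + 1} :=
    fun n w _ => (hasDerivAt_sineTerm hg k n τ w).differentiableAt.differentiableWithinAt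
  have hle : ∀ n w, w ∈ {z' : ℂ | |z'.im| < |z.im| + 1} → ‖sineTerm g k n τ w‖ ≤ _ :=
    fun n w hw => norm_sineTerm_le hb k n hτ le_rfl (le_of_lt hw)
  have h1 := (differentiableOn_tsum_of_summable_norm hu hd hU hle).differentiableAt
    (hU.mem_nhds hz)
  have h2 := (hasSum_deriv_of_summable_norm hu hd hU hle hz).tsum_eq
  simp only [(hasDerivAt_sineTerm hg k _ τ z).deriv] at h2
  rw [h2]
  exact h1.hasDerivAt

lemma hasDerivAt_sineTerm_left (n : ℕ) (τ z : ℂ) :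
    HasDerivAt (fun τ => sineTerm sin 0 n τ z) (π * I / 4 * sineTerm sin 2 n τ z) τ := by
  unfold sineTerm
  have h := ((((hasDerivAt_id τ).const_mul (π * I : ℂ)).mul_const
    (((n : ℂ) + 1 / 2) ^ 2)).cexp.const_mul ((-1 : ℂ) ^ n)).mul_const
      ((2 * (n : ℂ) + 1) ^ 0 * sin ((2 * n + 1) * z))
  refine h.congr_deriv ?_
  simp only [id]
  ring

/-- Termwise differentiation in the variable `τ`. -/
lemma hasDerivAt_tsum_sineTerm_left {τ : ℂ} (hτ : 0 < τ.im) (z : ℂ) :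
    HasDerivAt (fun τ => ∑' n : ℕ, sineTerm sin 0 n τ z)
      (π * I / 4 * ∑' n : ℕ, sineTerm sin 2 n τ z) τ := by
  have hU : IsOpen {t : ℂ | τ.im / 2 < t.im} := isOpen_lt continuous_const continuous_im
  have hz : τ ∈ {t : ℂ | τ.im / 2 < t.im} := half_lt_self hτ
  have hu := summable_exp_neg_sq (|z.im| + (0 : ℕ)) (half_pos hτ)
  have hd : ∀ n, DifferentiableOn ℂ (fun t => sineTerm sin 0 n t z) {t : ℂ | τ.im / 2 < t.im} :=
    fun n w _ => (hasDerivAt_sineTerm_left n w z).differentiableAt.differentiableWithinAt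
  have hle : ∀ n w, w ∈ {t : ℂ | τ.im / 2 < t.im} → ‖sineTerm sin 0 n w z‖ ≤ _ :=
    fun n w hw => norm_sineTerm_le norm_sin_le_exp 0 n (half_pos hτ) (le_of_lt hw) le_rfl
  have h1 := (differentiableOn_tsum_of_summable_norm hu hd hU hle).differentiableAt
    (hU.mem_nhds hz)
  have h2 := (hasSum_deriv_of_summable_norm hu hd hU hle hz).tsum_eq
  simp only [(hasDerivAt_sineTerm_left _ τ z).deriv, tsum_mul_left] at h2
  rw [h2]
  exact h1.hasDerivAt

lemma hasDerivAt_thetaSum {τ : ℂ} (hτ : 0 < τ.im) (z : ℂ) :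
    HasDerivAt (thetaSum τ) (2 * ∑' n : ℕ, sineTerm cos 1 n τ z) z :=
  (hasDerivAt_tsum_sineTerm hasDerivAt_sin norm_sin_le_exp 0 hτ z).const_mul 2

lemma deriv_deriv_thetaSum {τ : ℂ} (hτ : 0 < τ.im) (z : ℂ) :
    deriv (deriv (thetaSum τ)) z = -(2 * ∑' n : ℕ, sineTerm sin 2 n τ z) := by
  have h : deriv (thetaSum τ) = fun z => 2 * ∑' n : ℕ, sineTerm cos 1 n τ z :=
    funext fun z => (hasDerivAt_thetaSum hτ z).deriv
  rw [h, ((hasDerivAt_tsum_sineTerm hasDerivAt_cos norm_cos_le_exp 1 hτ z).const_mul 2).deriv,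
    ← mul_neg, ← tsum_neg]
  congr 2
  ext n
  simp [sineTerm]

/-- The heat equation for the theta function. -/
lemma hasDerivAt_thetaSum_left {τ : ℂ} (hτ : 0 < τ.im) (z : ℂ) :
    HasDerivAt (fun τ => thetaSum τ z) (-(π * I / 4) * deriv (deriv (thetaSum τ)) z) τ := by
  rw [deriv_deriv_thetaSum hτ]
  refine ((hasDerivAt_tsum_sineTerm_left hτ z).const_mul 2).congr_deriv ?_
  ring

lemma thetaSum_eq_jacobiTheta₂ {τ : ℂ} (hτ : 0 < τ.im) (z : ℂ) :
    thetaSum τ z =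
      -I * exp (π * I * τ / 4 + I * z) * jacobiTheta₂ (z / π + 1 / 2 + τ / 2) τ := by
  have hπ : (π : ℂ) ≠ 0 := by exact_mod_cast Real.pi_ne_zero
  have h := (hasSum_jacobiTheta₂_term (z / π + 1 / 2 + τ / 2) hτ).nat_add_neg_add_one
  rw [thetaSum, ← h.tsum_eq, ← tsum_mul_left, ← tsum_mul_left]
  refine tsum_congr fun n => ?_
  have e1 : -I * exp (π * I * τ / 4 + I * z) * jacobiTheta₂_term n (z / π + 1 / 2 + τ / 2) τ =
      -I * ((-1) ^ n * exp (π * I * τ * ((n : ℂ) + 1 / 2) ^ 2) * exp (((2 * n + 1) * z) * I)) := by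
    rw [jacobiTheta₂_term, ← exp_pi_mul_I, ← exp_nat_mul, mul_assoc, ← exp_add, ← exp_add,
      ← exp_add]
    congr 2
    push_cast
    field_simp
    ring
  have e2 : -I * exp (π * I * τ / 4 + I * z) *
      jacobiTheta₂_term (-(n + 1)) (z / π + 1 / 2 + τ / 2) τ =
      I * ((-1) ^ n * exp (π * I * τ * ((n : ℂ) + 1 / 2) ^ 2) *
        exp (-((2 * n + 1) * z) * I)) := by
    have : ((-1 : ℂ)) ^ n = -exp (-((n + 1) * (π * I))) := by
      rw [exp_neg, ← Nat.cast_add_one, exp_nat_mul, exp_pi_mul_I, pow_succ]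
      rcases neg_one_pow_eq_or ℂ n with h | h <;> simp [h]
    rw [jacobiTheta₂_term, this, neg_mul (exp _), neg_mul (_ * _), mul_neg, neg_mul, neg_mul,
      mul_assoc, ← exp_add, ← exp_add, ← exp_add]
    congr 3
    push_cast
    field_simp
    ring
  rw [mul_add, e1, e2, sineTerm, sin]
  ring

@[simp] lemma thetaSum_zero (τ : ℂ) : thetaSum τ 0 = 0 := by simp [thetaSum, sineTerm]

lemma thetaSum_add_pi (τ z : ℂ) : thetaSum τ (z + π) = -1 * thetaSum τ z := by
  rw [thetaSum, thetaSum, mul_left_comm, ← tsum_mul_left (a := (-1 : ℂ))]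
  congr 1
  refine tsum_congr fun n => ?_
  have : (2 * (n : ℂ) + 1) * (z + π) = (2 * n + 1) * z + π + n * (2 * π) := by ring
  rw [sineTerm, sineTerm, this, sin_add_nat_mul_two_pi, sin_add_pi]
  ring

lemma thetaSum_add_pi_mul {τ : ℂ} (hτ : 0 < τ.im) (z : ℂ) :
    thetaSum τ (z + π * τ) = thetaFactor τ z * thetaSum τ z := by
  have hπ : (π : ℂ) ≠ 0 := by exact_mod_cast Real.pi_ne_zero
  have h1 : (z + π * τ) / π + 1 / 2 + τ / 2 = z / π + 1 / 2 + τ / 2 + τ := by field_simp; ring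
  rw [thetaSum_eq_jacobiTheta₂ hτ, thetaSum_eq_jacobiTheta₂ hτ, h1, jacobiTheta₂_add_left',
    thetaFactor]
  have h2 : exp (π * I * τ / 4 + I * (z + π * τ)) *
      exp (-π * I * (τ + 2 * (z / π + 1 / 2 + τ / 2))) =
      -(exp (-(π * I * τ) - 2 * I * z) * exp (π * I * τ / 4 + I * z)) := by
    rw [← exp_add, ← exp_add, ← exp_sub_pi_mul_I]
    congr 1
    field_simp
    ring
  linear_combination (-I * jacobiTheta₂ (z / π + 1 / 2 + τ / 2) τ) * h2

lemma exists_thetaSum_eq {τ : ℂ} (hτ : 0 < τ.im) :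
    ∃ C, ∀ z, thetaSum τ z = C * sigmaProd τ z :=
  exists_eq_const_mul_sigmaProd hτ (fun z => (hasDerivAt_thetaSum hτ z).differentiableAt)
    (thetaSum_zero τ) (thetaSum_add_pi τ) (thetaSum_add_pi_mul hτ)

section Eta

open UpperHalfPlane hiding I
open EisensteinSeries SummationFilter

/-- The rescaled general term of the series defining `ζ(ω₁)`, at the lattice point `l`. -/
def zetaTerm (l : ℂ) : ℂ := 1 / (1 - 2 * l) + 1 / (2 * l) + 1 / (2 * l) ^ 2

lemma one_sub_two_mul_ne_zero (z : ℍ) (m n : ℤ) : 1 - 2 * ((m : ℂ) * z + n) ≠ 0 := by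
  have h := linear_ne_zero (cd := ![((2 * m : ℤ) : ℝ), ((2 * n - 1 : ℤ) : ℝ)]) z fun h => by
    have h1 := congrFun h 1
    simp only [Matrix.cons_val_one, Matrix.cons_val_fin_one, Pi.zero_apply, Int.cast_eq_zero] at h1
    omega
  simp only [Matrix.cons_val_zero, Matrix.cons_val_one, Matrix.cons_val_fin_one] at h
  push_cast at h
  exact fun h' => h (by linear_combination -h')

lemma isBigO_one_sub_two_mul_inv (z : ℍ) :
    (fun m : Fin 2 → ℤ => (1 - 2 * ((m 0 : ℂ) * z + m 1))⁻¹) =O[cofinite] fun m => ‖m‖⁻¹ := by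
  let e : (Fin 2 → ℤ) → (Fin 2 → ℤ) := fun m => ![2 * m 0, 2 * m 1 - 1]
  have he : Function.Injective e := fun m n h => by
    have h0 := congrFun h 0
    have h1 := congrFun h 1
    simp only [e, Matrix.cons_val_zero, Matrix.cons_val_one, Matrix.cons_val_fin_one] at h0 h1
    ext i
    fin_cases i
    · simpa using h0
    · show m 1 = n 1
      omega
  have h := (isBigO_linear_add_const_vec z 0 0).comp_tendsto he.tendsto_cofinite
  refine ((h.neg_left.congr_left fun m => ?_).trans (Asymptotics.IsBigO.of_bound 1 ?_))
  · simp only [e, Function.comp, Matrix.cons_val_zero, Matrix.cons_val_one,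
      Matrix.cons_val_fin_one, ← inv_neg]
    push_cast
    congr 1
    ring
  · filter_upwards [eventually_cofinite_ne (0 : Fin 2 → ℤ)] with m hm
    rw [one_mul, Function.comp, norm_inv, norm_inv, norm_norm, norm_norm]
    refine inv_anti₀ (norm_pos_iff.2 hm) ((pi_norm_le_iff_of_nonneg (norm_nonneg _)).2 fun i => ?_)
    refine le_trans ?_ (norm_le_pi_norm (e m) i)
    rw [Int.norm_eq_abs, Int.norm_eq_abs, ← Int.cast_abs, ← Int.cast_abs, Int.cast_le]
    fin_cases i
    · show |m 0| ≤ |2 * m 0|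
      grind
    · show |m 1| ≤ |2 * m 1 - 1|
      grind

lemma summable_zetaTerm (z : ℍ) :
    Summable fun p : ℤ × ℤ => zetaTerm ((p.1 : ℂ) * z + p.2) := by
  have H : Summable fun m : Fin 2 → ℤ => zetaTerm ((m 0 : ℂ) * z + m 1) := by
    refine summable_of_isBigO_rpow_norm (a := 3) (by norm_num) ?_
    have h0 := isBigO_linear_add_const_vec z 0 0
    have h := ((h0.mul h0).mul (isBigO_one_sub_two_mul_inv z)).const_mul_left (1 / 4)
    refine (h.congr' ?_ (.of_forall fun m => ?_))
    · filter_upwards [eventually_cofinite_ne (0 : Fin 2 → ℤ)] with m hm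
      have h1 : (m 0 : ℂ) * z + m 1 ≠ 0 := by
        simpa using linear_ne_zero (cd := fun i => (m i : ℝ)) z fun h => hm (by
          ext i; simpa using congrFun h i)
      have h2 := one_sub_two_mul_ne_zero z (m 0) (m 1)
      simp only [Int.cast_zero, add_zero, zetaTerm]
      generalize (m 0 : ℂ) * z + m 1 = l at h1 h2
      grind
    · norm_cast
      simp only [← inv_pow]
      ring
  exact (finTwoArrowEquiv ℤ).symm.summable_iff.mpr H

lemma tsum_sub_eq_zero {f : ℤ → ℂ} (hf : Tendsto f cofinite (𝓝 0))
    (hs : Summable fun m => f m - f (m + 1)) : ∑' m, (f m - f (m + 1)) = 0 := by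
  rw [← tsum_eq_of_summable_unconditional (L := symmetricIco ℤ) hs]
  refine HasSum.tsum_eq (hasSum_symmetricIco_int_iff.2 ?_)
  have h1 : Tendsto (fun N : ℕ => f (-N)) atTop (𝓝 0) := by
    rw [← Nat.cofinite_eq_atTop]
    exact hf.comp (Function.Injective.tendsto_cofinite fun a b h => by simpa using h)
  have h2 : Tendsto (fun N : ℕ => f N) atTop (𝓝 0) := by
    rw [← Nat.cofinite_eq_atTop]
    exact hf.comp Nat.cast_injective.tendsto_cofinite
  simpa only [Finset.sum_Ico_int_sub, sub_zero] using h1.sub h2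

lemma tsum_zetaTerm_add_neg (z : ℍ) (m : ℤ) :
    ∑' n : ℤ, (zetaTerm ((m : ℂ) * z + n) + zetaTerm (-((m : ℂ) * z + n))) =
      1 / 2 * e2Summand m z := by
  let f : ℤ → ℂ := fun n => (1 - 2 * ((m : ℂ) * z + n))⁻¹
  have hf : Tendsto f cofinite (𝓝 0) := by
    have h := (linear_inv_isBigO_right 1 ((m : ℂ) * z - 1 / 2)).trans_tendsto
      (tendsto_inv₀_cobounded.comp (Metric.cobounded_eq_cocompact (α := ℝ) ▸
        Int.tendsto_coe_cofinite))
    refine ((h.const_mul (-1 / 2)).congr fun n => ?_).trans_eq (by rw [mul_zero])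
    simp only [f]
    rw [show (1 : ℂ) - 2 * (m * z + n) = -2 * (((1 : ℤ) : ℂ) * (m * z - 1 / 2) + n) by
      push_cast; ring, mul_inv]
    ring
  have hr : Summable fun n : ℤ => zetaTerm ((m : ℂ) * z + n) + zetaTerm (-((m : ℂ) * z + n)) := by
    have h1 := (summable_zetaTerm z).prod_factor m
    have h2 := (Equiv.neg ℤ).summable_iff.2 ((summable_zetaTerm z).prod_factor (-m))
    refine h1.add (h2.congr fun n => ?_)
    simp
    ring_nf
  have he := (e2Summand_summable m z).mul_left (1 / 2)
  have key : ∀ n : ℤ, zetaTerm ((m : ℂ) * z + n) + zetaTerm (-((m : ℂ) * z + n)) =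
      (f n - f (n + 1)) + 1 / 2 * eisSummand 2 ![m, n] z := fun n => by
    have h : f (n + 1) = -(1 + 2 * ((m : ℂ) * z + n))⁻¹ := by
      simp only [f, ← inv_neg]
      push_cast
      congr 1
      ring
    rw [h]
    simp only [f, zetaTerm, eisSummand, Matrix.cons_val_zero, Matrix.cons_val_one,
      Matrix.cons_val_fin_one, zpow_neg, zpow_ofNat, mul_pow, mul_neg, neg_sq, one_div, inv_neg,
      mul_inv, sub_neg_eq_add]
    ring
  have hs : Summable fun n => f n - f (n + 1) :=
    (hr.sub he).congr fun n => by rw [key]; ring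
  rw [tsum_congr key, hs.tsum_add he, tsum_sub_eq_zero hf hs, tsum_mul_left, zero_add, e2Summand]

lemma tsum_zetaTerm (z : ℍ) :
    ∑' p : ℤ × ℤ, zetaTerm ((p.1 : ℂ) * z + p.2) = 1 / 4 * G2 z := by
  have hs := summable_zetaTerm z
  have hn : Summable fun p : ℤ × ℤ => zetaTerm (-((p.1 : ℂ) * z + p.2)) :=
    ((Equiv.neg (ℤ × ℤ)).summable_iff.2 hs).congr fun p => by simp; ring_nf
  have h1 : ∑' p : ℤ × ℤ, zetaTerm (-((p.1 : ℂ) * z + p.2)) =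
      ∑' p : ℤ × ℤ, zetaTerm ((p.1 : ℂ) * z + p.2) := by
    rw [← (Equiv.neg (ℤ × ℤ)).tsum_eq]
    refine tsum_congr fun p => ?_
    simp
    ring_nf
  have h2 := (hs.add hn).tsum_prod
  have h3 := (hs.add hn).prod
  simp only [tsum_zetaTerm_add_neg] at h2 h3
  rw [hs.tsum_add hn, h1, ← tsum_eq_of_summable_unconditional (L := symmetricIcc ℤ) h3,
    tsum_mul_left, ← G2] at h2
  linear_combination 1 / 2 * h2

lemma tsum_prodCoeff (z : ℍ) :
    -1 + 6 * ∑' n, prodCoeff (exp (2 * π * I * z)) n = -(3 / π ^ 2) * G2 z := by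
  have hπ : (π : ℂ) ≠ 0 := by exact_mod_cast Real.pi_ne_zero
  set Q := exp (2 * π * I * z) with hQd
  have hQ : ‖Q‖ < 1 := norm_exp_two_pi_I_lt_one z
  have h : ∑' n, prodCoeff Q n = 4 * ∑' n : ℕ+, ArithmeticFunction.sigma 1 n * Q ^ (n : ℕ) := by
    rw [← tsum_prod_pow_eq_tsum_sigma 1 hQ,
      tsum_pnat_eq_tsum_succ (f := fun d => ∑' c : ℕ+, (c : ℂ) ^ 1 * Q ^ (d * c : ℕ)),
      ← tsum_mul_left]
    refine tsum_congr fun n => ?_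
    have hQn : ‖Q ^ (n + 1)‖ < 1 := by
      rw [norm_pow]
      exact pow_lt_one₀ (norm_nonneg _) hQ n.succ_ne_zero
    have h0 := tsum_coe_mul_geometric_of_norm_lt_one hQn
    rw [prodCoeff, mul_div_assoc, ← h0,
      tsum_pnat_eq_tsum_succ (f := fun c : ℕ => (c : ℂ) ^ 1 * Q ^ ((n + 1) * c)),
      tsum_eq_zero_add' (f := fun c : ℕ => (c : ℂ) * (Q ^ (n + 1)) ^ c)]
    · simp [pow_mul]
    · have hg : Summable fun c : ℕ => (c : ℂ) * (Q ^ (n + 1)) ^ c := by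
        simpa using summable_pow_mul_geometric_of_norm_lt_one 1 hQn
      exact (summable_nat_add_iff 1).2 hg
  rw [h, G2_eq_tsum_cexp, riemannZeta_two, ← hQd]
  field_simp
  ring

/-- The quasi-period `η₁` is a multiple of the Eisenstein series of weight `2`. -/
lemma eta1_eq {w1 b : ℂ} (hw1 : w1 ≠ 0) (hb : 0 < (tau w1 b).im) :
    eta1 w1 b = 1 / (4 * w1) * G2 ⟨tau w1 b, hb⟩ := by
  have hlat : ∀ p : ℤ × ℤ, lat w1 b p = w1 * (2 * ((p.2 : ℂ) * tau w1 b + p.1)) := fun p => by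
    rw [lat, tau]
    field_simp
    ring
  have hterm : ∀ p : ℤ × ℤ, 1 / (w1 - lat w1 b p) + 1 / lat w1 b p + w1 / lat w1 b p ^ 2 =
      w1⁻¹ * zetaTerm ((p.2 : ℂ) * tau w1 b + p.1) := fun p => by
    rw [hlat, zetaTerm]
    set l := 2 * ((p.2 : ℂ) * tau w1 b + p.1)
    rw [show w1 - w1 * l = w1 * (1 - l) by ring]
    simp only [mul_inv, div_eq_mul_inv, mul_pow]
    field_simp
  have hs : Summable fun p : ℤ × ℤ => w1⁻¹ * zetaTerm ((p.2 : ℂ) * tau w1 b + p.1) :=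
    ((Equiv.prodComm ℤ ℤ).summable_iff.2 (summable_zetaTerm ⟨tau w1 b, hb⟩)).mul_left _
  have h0 := hs.tsum_subtype_add_tsum_subtype_compl {0}
  have h1 := (Equiv.prodComm ℤ ℤ).tsum_eq
    (fun p : ℤ × ℤ => w1⁻¹ * zetaTerm ((p.1 : ℂ) * tau w1 b + p.2))
  have h2 : ∑' p : ℤ × ℤ, zetaTerm ((p.1 : ℂ) * tau w1 b + p.2) = _ :=
    tsum_zetaTerm ⟨tau w1 b, hb⟩
  simp only [Equiv.prodComm_apply, Prod.fst_swap, Prod.snd_swap] at h1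
  have h3 : w1⁻¹ * zetaTerm ((((0 : ℤ × ℤ).2 : ℤ) : ℂ) * tau w1 b + ((0 : ℤ × ℤ).1 : ℤ)) =
      1 / w1 := by
    simp [zetaTerm]
  rw [eta1, wzeta]
  simp only [hterm]
  rw [h1, tsum_mul_left (f := fun p : ℤ × ℤ => zetaTerm ((p.1 : ℂ) * tau w1 b + p.2)), h2,
    tsum_singleton (0 : ℤ × ℤ) (fun p : ℤ × ℤ => w1⁻¹ * zetaTerm ((p.2 : ℂ) * tau w1 b + p.1)),
    h3] at h0
  refine h0.trans ?_
  rw [one_div, one_div, mul_inv]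
  ring

end Eta

/-- The addition formula relating the logarithmic derivatives of `sigmaProd`. -/
lemma sigmaProd_three_term_div {τ u v w : ℂ} (hτ : 0 < τ.im) (huv : u + v = w)
    (hu : sigmaProd τ u ≠ 0) (hv : sigmaProd τ v ≠ 0) (hw : sigmaProd τ w ≠ 0) :
    deriv (deriv (sigmaProd τ)) u / sigmaProd τ u + deriv (deriv (sigmaProd τ)) v / sigmaProd τ v +
      deriv (deriv (sigmaProd τ)) w / sigmaProd τ w +
      2 * (deriv (sigmaProd τ) u / sigmaProd τ u * (deriv (sigmaProd τ) v / sigmaProd τ v) -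
        deriv (sigmaProd τ) v / sigmaProd τ v * (deriv (sigmaProd τ) w / sigmaProd τ w) -
        deriv (sigmaProd τ) u / sigmaProd τ u * (deriv (sigmaProd τ) w / sigmaProd τ w)) =
      deriv (deriv (deriv (sigmaProd τ))) 0 := by
  subst huv
  have h := sigmaProd_three_term hτ u hv
  field_simp
  linear_combination h

lemma RR_ne_zero {w1 : ℂ} (hw1 : w1 ≠ 0) : RR w1 ≠ 0 :=
  div_ne_zero (mul_ne_zero two_ne_zero hw1) (by exact_mod_cast Real.pi_ne_zero)

lemma theta_zero_eq (w1 b x : ℂ) : theta 0 w1 b x = thetaSum (tau w1 b) (x / RR w1) := by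
  simp [theta, theta1, thetaSum, sineTerm, mul_div_assoc]

lemma thetaX_zero_eq {w1 b : ℂ} (hb : 0 < (tau w1 b).im) (x : ℂ) :
    thetaX 0 w1 b x = deriv (thetaSum (tau w1 b)) (x / RR w1) / RR w1 := by
  simp only [thetaX, theta_zero_eq]
  have h := (hasDerivAt_thetaSum hb (x / RR w1)).differentiableAt.hasDerivAt
  exact ((h.comp x ((hasDerivAt_id x).div_const (RR w1))).congr_deriv (mul_one_div _ _)).deriv

/-- The heat equation for `θ₁` in the variables `x` and `β`. -/
lemma thetaB_zero_eq {w1 b : ℂ} (hw1 : w1 ≠ 0) (hb : 0 < (tau w1 b).im) (x : ℂ) :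
    thetaB 0 w1 b x = deriv (deriv (thetaSum (tau w1 b))) (x / RR w1) / (2 * RR w1 ^ 2) := by
  have hπ : (π : ℂ) ≠ 0 := by exact_mod_cast Real.pi_ne_zero
  simp only [thetaB, theta_zero_eq]
  have ht : HasDerivAt (tau w1) (π * I / (2 * w1) / w1) b := by
    have := ((((hasDerivAt_id b).const_mul (π * I : ℂ)).div_const (2 * w1)).div_const w1)
    rwa [mul_one] at this
  have h := (hasDerivAt_thetaSum_left hb (x / RR w1)).comp b ht
  refine h.deriv.trans ?_
  generalize deriv (deriv (thetaSum (tau w1 b))) (x / RR w1) = D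
  rw [RR]
  field_simp
  linear_combination (-4 * D) * I_sq

lemma eta1_eq_deriv_sigmaProd {w1 b : ℂ} (hw1 : w1 ≠ 0) (hb : 0 < (tau w1 b).im) :
    3 * eta1 w1 b / w1 = -deriv (deriv (deriv (sigmaProd (tau w1 b)))) 0 / RR w1 ^ 2 := by
  have hπ : (π : ℂ) ≠ 0 := by exact_mod_cast Real.pi_ne_zero
  have h := tsum_prodCoeff ⟨tau w1 b, hb⟩
  rw [deriv_deriv_deriv_sigmaProd_zero hb, eta1_eq hw1 hb]
  rw [RR, show -1 + 6 * ∑' n, prodCoeff (exp (2 * π * I * tau w1 b)) n = _ from h]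
  field_simp
  ring

end Auxiliary

/-- ∑_{r,s=±}(φ₁(x−ry)φ₁(x−sz) + φ₁(y−rx)φ₁(y−sz) + φ₁(z−rx)φ₁(z−sy))
= 2∑_{r=±}(θ̇₁(x−ry)/θ₁(x−ry) + θ̇₁(x−rz)/θ₁(x−rz) + θ̇₁(y−rz)/θ₁(y−rz) + 3η₁/(2ω₁)). -/
theorem statement15 (w1 b : ℂ) (hw1 : w1 ≠ 0) (hb : 0 < (tau w1 b).im)
    (x y z : ℂ)
    (hθ1 : ∀ r : ℂ, r = 1 ∨ r = -1 →
      theta 0 w1 b (x - r * y) ≠ 0 ∧ theta 0 w1 b (x - r * z) ≠ 0 ∧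
      theta 0 w1 b (y - r * z) ≠ 0 ∧ theta 0 w1 b (y - r * x) ≠ 0 ∧
      theta 0 w1 b (z - r * x) ≠ 0 ∧ theta 0 w1 b (z - r * y) ≠ 0) :
    (∑ r ∈ pmSet, ∑ s ∈ pmSet,
        (phi 0 w1 b (x - r * y) * phi 0 w1 b (x - s * z)
          + phi 0 w1 b (y - r * x) * phi 0 w1 b (y - s * z)
          + phi 0 w1 b (z - r * x) * phi 0 w1 b (z - s * y)))
      = 2 * ∑ r ∈ pmSet,
          (thetaB 0 w1 b (x - r * y) / theta 0 w1 b (x - r * y)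
            + thetaB 0 w1 b (x - r * z) / theta 0 w1 b (x - r * z)
            + thetaB 0 w1 b (y - r * z) / theta 0 w1 b (y - r * z)
            + 3 * eta1 w1 b / (2 * w1)) := by
  have hR := RR_ne_zero hw1
  set τ := tau w1 b
  set R := RR w1
  obtain ⟨C, hC⟩ := exists_thetaSum_eq hb
  have hCP : thetaSum τ = fun z => C * sigmaProd τ z := funext hC
  have hd1 : ∀ z, deriv (thetaSum τ) z = C * deriv (sigmaProd τ) z := fun z => by
    rw [hCP, deriv_const_mul_field]
  have hd2 : ∀ z, deriv (deriv (thetaSum τ)) z = C * deriv (deriv (sigmaProd τ)) z := fun z => by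
    rw [funext hd1, deriv_const_mul_field]
  have hne : ∀ u, theta 0 w1 b u ≠ 0 → C ≠ 0 ∧ sigmaProd τ (u / R) ≠ 0 := fun u hu => by
    rw [theta_zero_eq, hC] at hu
    exact ⟨left_ne_zero_of_mul hu, right_ne_zero_of_mul hu⟩
  obtain ⟨⟨hC0, hxy⟩, ⟨-, hxz⟩, -, hyz⟩ :
      (C ≠ 0 ∧ sigmaProd τ ((x - y) / R) ≠ 0) ∧ (C ≠ 0 ∧ sigmaProd τ ((x - z) / R) ≠ 0) ∧
      (C ≠ 0 ∧ sigmaProd τ ((y - z) / R) ≠ 0) := by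
    have h := hθ1 1 (.inl rfl)
    simp only [one_mul] at h
    exact ⟨hne _ h.1, hne _ h.2.1, hne _ h.2.2.1⟩
  obtain ⟨hxy', hxz', hyz'⟩ : sigmaProd τ ((x + y) / R) ≠ 0 ∧ sigmaProd τ ((x + z) / R) ≠ 0 ∧
      sigmaProd τ ((y + z) / R) ≠ 0 := by
    have h := hθ1 (-1) (.inr rfl)
    simp only [neg_one_mul, sub_neg_eq_add] at h
    exact ⟨(hne _ h.1).2, (hne _ h.2.1).2, (hne _ h.2.2.1).2⟩
  have hphi : ∀ u, phi 0 w1 b u =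
      deriv (sigmaProd τ) (u / R) / sigmaProd τ (u / R) / R := fun u => by
    rw [phi, thetaX_zero_eq hb, theta_zero_eq, hd1, hC, div_right_comm, mul_div_mul_left _ _ hC0]
  have hneg : ∀ u v, phi 0 w1 b (u - v) = -phi 0 w1 b (v - u) := fun u v => by
    rw [hphi, hphi, ← neg_sub v u, neg_div R, deriv_sigmaProd_neg, sigmaProd_neg, div_neg, neg_div]
  have hB : ∀ u, thetaB 0 w1 b u / theta 0 w1 b u =
      deriv (deriv (sigmaProd τ)) (u / R) / sigmaProd τ (u / R) / (2 * R ^ 2) := fun u => by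
    rw [thetaB_zero_eq hw1 hb, theta_zero_eq, hd2, hC, div_right_comm, mul_div_mul_left _ _ hC0]
  have hη : 3 * eta1 w1 b / (2 * w1) =
      -deriv (deriv (deriv (sigmaProd τ))) 0 / (2 * R ^ 2) := by
    linear_combination (1 / 2) * eta1_eq_deriv_sigmaProd hw1 hb
  have e1 := sigmaProd_three_term_div hb (by ring : (x - y) / R + (y - z) / R = (x - z) / R)
    hxy hyz hxz
  have e2 := sigmaProd_three_term_div hb (by ring : (x - y) / R + (y + z) / R = (x + z) / R)
    hxy hyz' hxz'
  have e3 := sigmaProd_three_term_div hb (by ring : (x - z) / R + (y + z) / R = (x + y) / R)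
    hxz hyz' hxy'
  have e4 := sigmaProd_three_term_div hb (by ring : (x + z) / R + (y - z) / R = (x + y) / R)
    hxz' hyz hxy'
  have hpm : ∀ f : ℂ → ℂ, ∑ r ∈ pmSet, f r = f 1 + f (-1) := fun f =>
    Finset.sum_pair (by norm_num)
  simp only [hpm, one_mul, neg_one_mul, sub_neg_eq_add]
  rw [hneg y x, hneg z x, hneg z y, add_comm y x, add_comm z x, add_comm z y]
  simp only [hB, hη, hphi]
  linear_combination (-1 / (2 * R ^ 2)) * (e1 + e2 + e3 + e4)

end Paper
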